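/- Let n be a non-negative integer. Then, as an identity in the field of rational functions Q(q, c, x, y): ∑_{k=0}^{n} (q^{-n};q)_k (x;q)_k (y;q)_k q^k / ((q;q)_k (c;q)_k) = ∑_{k=0}^{n} (-1)^k (q^{-n};q)_k (x;q)_k (c/y;q)_k x^{n-k} y^k q^{nk - k(k-1)/2} / ((q;q)_k (c;q)_k). -/

import Mathlib

open Finset

/-- The q-Pochhammer symbol `(a;q)_n = ∏_{j=0}^{n-1} (1 - a q^j)`. -/
noncomputable def qPoch {F : Type*} [Field F] (q a : F) (n : ℕ) : F :=
  ∏ j ∈ Finset.range n, (1 - a * q ^ j)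

/-- The field of rational functions `ℚ(q, c, x, y)`. -/
abbrev F4 : Type := FractionRing (MvPolynomial (Fin 4) ℚ)

noncomputable def q : F4 := algebraMap (MvPolynomial (Fin 4) ℚ) F4 (MvPolynomial.X 0)
noncomputable def c : F4 := algebraMap (MvPolynomial (Fin 4) ℚ) F4 (MvPolynomial.X 1)
noncomputable def x : F4 := algebraMap (MvPolynomial (Fin 4) ℚ) F4 (MvPolynomial.X 2)
noncomputable def y : F4 := algebraMap (MvPolynomial (Fin 4) ℚ) F4 (MvPolynomial.X 3)


section helpers
variable {K : Type*} [Field K]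

lemma qp_zero (Q a : K) : qPoch Q a 0 = 1 := by simp [qPoch]

lemma qp_succ (Q a : K) (n : ℕ) : qPoch Q a (n+1) = qPoch Q a n * (1 - a * Q^n) := by
  simp [qPoch, Finset.prod_range_succ]

lemma qp_succ_left (Q a : K) (n : ℕ) : qPoch Q a (n+1) = (1 - a) * qPoch Q (a * Q) n := by
  simp only [qPoch, Finset.prod_range_succ']
  rw [mul_comm]
  congr 1
  · simp
  · refine Finset.prod_congr rfl fun i _ => ?_
    ring

lemma qp_add (Q a : K) (j m : ℕ) : qPoch Q a (j+m) = qPoch Q a j * qPoch Q (a * Q^j) m := by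
  simp only [qPoch, Finset.prod_range_add]
  congr 1
  refine Finset.prod_congr rfl fun i _ => ?_
  ring

lemma qp_ne (Q a : K) (h : ∀ i : ℕ, 1 - a * Q^i ≠ 0) (n : ℕ) : qPoch Q a n ≠ 0 :=
  Finset.prod_ne_zero_iff.2 fun i _ => h i

/-- helper coefficient -/
noncomputable def AA (Q : K) (N m : ℕ) : K := qPoch Q ((Q^N)⁻¹) m / qPoch Q Q m

lemma AA_zero (Q : K) (N : ℕ) : AA Q N 0 = 1 := by simp [AA, qp_zero]

lemma AA_big (Q : K) (hQ : Q ≠ 0) {N m : ℕ} (h : N < m) : AA Q N m = 0 := by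
  unfold AA
  have : qPoch Q ((Q^N)⁻¹) m = 0 := by
    refine Finset.prod_eq_zero (Finset.mem_range.2 h) ?_
    rw [inv_mul_cancel₀ (pow_ne_zero _ hQ), sub_self]
  rw [this, zero_div]

variable {Q : K} (hQ : Q ≠ 0) (h1 : ∀ i : ℕ, 1 - Q * Q^i ≠ 0)
include hQ h1

lemma AA_r (N m : ℕ) : AA Q N (m+1) = AA Q N m * (1 - (Q^N)⁻¹ * Q^m) / (1 - Q * Q^m) := by
  have := qp_ne Q Q h1 m
  have := h1 m
  unfold AA
  rw [qp_succ, qp_succ]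
  field_simp

lemma AA_d (N m : ℕ) : AA Q (N+1) (m+1) = AA Q N m * (1 - (Q^(N+1))⁻¹) / (1 - Q * Q^m) := by
  have := qp_ne Q Q h1 m
  have := h1 m
  unfold AA
  rw [qp_succ_left, qp_succ]
  have e : (Q^(N+1))⁻¹ * Q = (Q^N)⁻¹ := by
    field_simp
    ring
  rw [e]
  field_simp

lemma AA_rec1 (N m : ℕ) : AA Q (N+1) (m+1) * Q^(m+1) = AA Q N (m+1) - AA Q N m := by
  rw [AA_d hQ h1, AA_r hQ h1]
  have := h1 m
  field_simp
  ring

lemma AA_rec2 (k j : ℕ) : AA Q (k+1) (j+1) * Q^((k+1)*(j+1)) =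
    Q^(j+1) * (AA Q k (j+1) * Q^(k*(j+1))) - Q^j * (AA Q k j * Q^(k*j)) := by
  rw [AA_d hQ h1, AA_r hQ h1]
  have := h1 j
  have e : Q^((k+1)*(j+1)) = Q^(k*j) * Q^k * Q^j * Q := by ring
  have e2 : Q^(k*(j+1)) = Q^(k*j) * Q^k := by ring
  rw [e, e2]
  field_simp
  ring

lemma lemA (N : ℕ) (b : K) : ∑ m ∈ range (N+1), AA Q N m * Q^m * qPoch Q b m = b^N := by
  induction N with
  | zero => simp [AA_zero, qp_zero]
  | succ N ih =>
    rw [Finset.sum_range_succ']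
    simp only [AA_rec1 hQ h1, sub_mul, Finset.sum_sub_distrib]
    have e := Finset.sum_range_succ' (fun m => AA Q N m * qPoch Q b m) (N+1)
    rw [Finset.sum_range_succ, AA_big Q hQ (Nat.lt_succ_self N)] at e
    simp only [AA_zero, zero_mul, add_zero] at e
    rw [pow_succ, ← ih, Finset.sum_mul]
    have : ∑ m ∈ range (N+1), AA Q N m * Q^m * qPoch Q b m * b =
      ∑ m ∈ range (N+1), AA Q N m * qPoch Q b m
       - ∑ m ∈ range (N+1), AA Q N m * qPoch Q b (m+1) := by
      rw [← Finset.sum_sub_distrib]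
      refine Finset.sum_congr rfl fun i _ => ?_
      rw [qp_succ]; ring
    rw [this, e]
    simp only [AA_zero, pow_zero]
    ring

lemma lemB (a : K) (k : ℕ) : ∀ y : K, (∀ i : ℕ, 1 - a * y * Q^i ≠ 0) →
    ∑ j ∈ range (k+1), AA Q k j * Q^(k*j) * (qPoch Q a j * y^j / qPoch Q (a*y) j)
      = qPoch Q y k / qPoch Q (a*y) k := by
  induction k with
  | zero => intro y _; simp [AA_zero, qp_zero]
  | succ k ih =>
    intro y hy
    have hy' : ∀ i : ℕ, 1 - a * (y*Q) * Q^i ≠ 0 := by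
      intro i
      have := hy (i+1)
      rwa [show a * (y*Q) * Q^i = a * y * Q^(i+1) by ring]
    have IH := ih (y*Q) hy'
    rw [qp_succ_left, qp_succ_left, mul_div_mul_comm, mul_assoc a y Q, ← IH, Finset.mul_sum]
    rw [Finset.sum_range_succ']
    simp only [AA_rec2 hQ h1, sub_mul, Finset.sum_sub_distrib]
    have e := Finset.sum_range_succ' (fun j => Q^j * (AA Q k j * Q^(k*j)) *
      (qPoch Q a j * y^j / qPoch Q (a*y) j)) (k+1)
    rw [Finset.sum_range_succ, AA_big Q hQ (Nat.lt_succ_self k)] at e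
    simp only [AA_zero, zero_mul, mul_zero, add_zero] at e
    have : ∑ j ∈ range (k+1), (1 - y)/(1 - a*y) * (AA Q k j * Q^(k*j) *
        (qPoch Q a j * (y*Q)^j / qPoch Q (a*(y*Q)) j)) =
      ∑ j ∈ range (k+1), Q^j * (AA Q k j * Q^(k*j)) * (qPoch Q a j * y^j / qPoch Q (a*y) j)
       - ∑ j ∈ range (k+1), Q^j * (AA Q k j * Q^(k*j)) *
          (qPoch Q a (j+1) * y^(j+1) / qPoch Q (a*y) (j+1)) := by
      rw [← Finset.sum_sub_distrib]
      refine Finset.sum_congr rfl fun i _ => ?_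
      have n1 := qp_ne Q (a*y) hy i
      have n2 := qp_ne Q (a*(y*Q)) hy' i
      have n3 := hy i
      have n4 : 1 - a*y ≠ 0 := by simpa using hy 0
      have E : qPoch Q (a*y) i * (1 - a*y*Q^i) = (1 - a*y) * qPoch Q (a*(y*Q)) i := by
        rw [← qp_succ, qp_succ_left, mul_assoc a y Q]
      have E2 : (1 - y)/(1 - a*y) * (AA Q k i * Q^(k*i) *
        (qPoch Q a i * (y*Q)^i / qPoch Q (a*(y*Q)) i)) =
        (1-y) * (AA Q k i * Q^(k*i) * (qPoch Q a i * (y*Q)^i)) /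
          (qPoch Q (a*y) i * (1 - a*y*Q^i)) := by
        rw [E]; field_simp
      rw [E2, qp_succ, qp_succ]
      rw [mul_pow]
      clear E2 E e IH
      generalize qPoch Q (a*y) i = P at *
      generalize Q^(k*i) = v at *
      generalize Q^i = w at *
      rw [pow_succ]
      rw [← mul_div_assoc, ← mul_div_assoc, div_sub_div _ _ n1 (mul_ne_zero n1 n3),
        div_eq_div_iff (mul_ne_zero n1 n3) (mul_ne_zero n1 (mul_ne_zero n1 n3))]
      ring
    rw [this, e]
    simp only [AA_zero, pow_zero, mul_zero]
    ring

lemma lemC (m j : ℕ) : AA Q (j+m) j * Q^((j+m)*j) * qPoch Q Q m * qPoch Q Q j =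
    (-1)^j * Q^(j*(j-1)/2) * qPoch Q Q (j+m) := by
  induction j with
  | zero => simp [AA_zero, qp_zero]
  | succ j ih =>
    have t : (j+1)*(j+1-1)/2 = j*(j-1)/2 + j := Nat.triangle_succ j
    rw [t, show j+1+m = (j+m)+1 by ring, AA_d hQ h1, qp_succ, qp_succ]
    have e : Q^((j+m+1)*(j+1)) = Q^((j+m)*j) * Q^j * Q^(j+m+1) := by ring
    have := h1 j
    have e3 : (1 - (Q^(j+m+1))⁻¹) * Q^(j+m+1) = -(1 - Q * Q^(j+m)) := by
      field_simp; ring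
    calc _ = (AA Q (j+m) j * Q^((j+m)*j) * qPoch Q Q m * qPoch Q Q j) * Q^j *
          ((1 - (Q^(j+m+1))⁻¹) * Q^(j+m+1)) := by rw [e]; field_simp
      _ = _ := by rw [ih, e3, pow_add Q _ j, pow_succ]; ring

lemma lemD (n j : ℕ) (hj : j ≤ n) (x : K) :
    ∑ k ∈ range (n+1), AA Q n k * qPoch Q x k * Q^k * (AA Q k j * Q^(k*j)) =
    (-1)^j * AA Q n j * qPoch Q x j * x^(n-j) * Q^(n*j) * (Q^(j*(j-1)/2))⁻¹ := by
  obtain ⟨N, rfl⟩ := Nat.exists_eq_add_of_le hj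
  rw [show j + N + 1 = j + (N+1) by ring, Finset.sum_range_add, Finset.sum_eq_zero, zero_add]
  · have key : ∀ m, AA Q (j+N) (j+m) * qPoch Q x (j+m) * Q^(j+m) *
        (AA Q (j+m) j * Q^((j+m)*j)) = ((-1)^j * Q^(j*(j-1)/2) * AA Q (j+N) j * qPoch Q x j * Q^j) *
          (AA Q N m * Q^m * qPoch Q (x*Q^j) m) := by
      intro m
      have C := lemC hQ h1 m j
      have n1 := qp_ne Q Q h1 j
      have n2 := qp_ne Q Q h1 m
      have n3 := qp_ne Q Q h1 (j+m)
      have e : AA Q (j+m) j * Q^((j+m)*j) = (-1)^j * Q^(j*(j-1)/2) * qPoch Q Q (j+m) /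
          (qPoch Q Q m * qPoch Q Q j) := by
        rw [← C]; field_simp
      rw [e, qp_add Q x]
      unfold AA
      rw [qp_add Q (Q^(j+N))⁻¹]
      have e2 : (Q^(j+N))⁻¹ * Q^j = (Q^N)⁻¹ := by rw [pow_add]; field_simp
      rw [e2]
      field_simp
      try ring
    simp only [key]
    rw [← Finset.mul_sum, lemA hQ h1, Nat.add_sub_cancel_left]
    have t : j*(j-1)/2*2 + j = j*j := by
      rw [Nat.div_mul_cancel (Nat.even_mul_pred_self j).two_dvd]
      cases j <;> simp; ring
    have e : Q^((j+N)*j) = Q^(j*(j-1)/2) * Q^(j*(j-1)/2) * Q^j * Q^(j*N) := by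
      rw [← pow_add, ← pow_add, ← pow_add]; congr 1; nlinarith
    rw [e, mul_pow, ← pow_mul]
    field_simp
  · intro k hk
    rw [AA_big Q hQ (Finset.mem_range.1 hk)]; simp

theorem general (n : ℕ) (c x y : K) (hy : y ≠ 0) (hc : ∀ i : ℕ, 1 - c * Q^i ≠ 0) :
    ∑ k ∈ Finset.range (n + 1),
        qPoch Q ((Q ^ n)⁻¹) k * qPoch Q x k * qPoch Q y k * Q ^ k /
          (qPoch Q Q k * qPoch Q c k) =
    ∑ k ∈ Finset.range (n + 1),
        (-1 : K) ^ k * qPoch Q ((Q ^ n)⁻¹) k * qPoch Q x k * qPoch Q (c / y) k *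
          x ^ (n - k) * y ^ k * Q ^ (n * k) * (Q ^ (k * (k - 1) / 2))⁻¹ /
          (qPoch Q Q k * qPoch Q c k) := by
  have hcy : c / y * y = c := div_mul_cancel₀ c hy
  have L : ∀ k ∈ range (n+1), qPoch Q ((Q ^ n)⁻¹) k * qPoch Q x k * qPoch Q y k * Q ^ k /
          (qPoch Q Q k * qPoch Q c k) = ∑ j ∈ range (n+1),
          (AA Q n k * qPoch Q x k * Q^k * (AA Q k j * Q^(k*j))) *
            (qPoch Q (c/y) j * y^j / qPoch Q c j) := by
    intro k hk
    have B := lemB hQ h1 (c/y) k y (by rwa [hcy])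
    rw [hcy] at B
    have B2 : ∑ j ∈ range (n+1), AA Q k j * Q^(k*j) * (qPoch Q (c/y) j * y^j / qPoch Q c j)
      = qPoch Q y k / qPoch Q c k := by
      rw [← B]
      symm
      apply Finset.sum_subset
      · intro i hi
        simp only [Finset.mem_range] at *
        omega
      · intro i _ hi
        simp only [Finset.mem_range] at hi
        rw [AA_big Q hQ (by omega)]; simp
    simp only [mul_assoc] at B2 ⊢
    simp only [← Finset.mul_sum]
    rw [B2]
    unfold AA
    have n3 := qp_ne Q Q h1 k
    have n4 := qp_ne Q c hc k
    field_simp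
  rw [Finset.sum_congr rfl L, Finset.sum_comm]
  refine Finset.sum_congr rfl fun j hj => ?_
  rw [← Finset.sum_mul, lemD hQ h1 n j (by simp only [Finset.mem_range] at hj; omega)]
  unfold AA
  have n3 := qp_ne Q Q h1 j
  have n4 := qp_ne Q c hc j
  field_simp

end helpers

lemma ne_aux (i0 : Fin 4) (i : ℕ) :
    (1 : F4) - algebraMap (MvPolynomial (Fin 4) ℚ) F4 (MvPolynomial.X i0) * q^i ≠ 0 := by
  intro h
  unfold q at h
  rw [← map_pow, ← map_mul, ← map_one (algebraMap (MvPolynomial (Fin 4) ℚ) F4), ← map_sub,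
    FaithfulSMul.algebraMap_eq_zero_iff] at h
  have := congrArg (MvPolynomial.eval (fun _ => (0:ℚ))) h
  simp at this

theorem jackson_transformation (n : ℕ) :
    ∑ k ∈ Finset.range (n + 1),
        qPoch q ((q ^ n)⁻¹) k * qPoch q x k * qPoch q y k * q ^ k /
          (qPoch q q k * qPoch q c k) =
    ∑ k ∈ Finset.range (n + 1),
        (-1 : F4) ^ k * qPoch q ((q ^ n)⁻¹) k * qPoch q x k * qPoch q (c / y) k *
          x ^ (n - k) * y ^ k * q ^ (n * k) * (q ^ (k * (k - 1) / 2))⁻¹ /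
          (qPoch q q k * qPoch q c k) := by
  have hX : ∀ i : Fin 4, algebraMap (MvPolynomial (Fin 4) ℚ) F4 (MvPolynomial.X i) ≠ 0 := by
    intro i h
    rw [FaithfulSMul.algebraMap_eq_zero_iff] at h
    exact MvPolynomial.X_ne_zero i h
  exact general (hX 0) (ne_aux 0) n c x y (hX 3) (ne_aux 1)
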